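/- Let X be a hypersurface of degree d and dimension n in P^{n+1} over F_q containing no F_q-line (i.e. k_X ≤ 0). Then N_q(X) = (d−1)·q^n + (d−2)·N_q(P^{n−1}) + 1 if and only if d = 2, n ∈ {1,2}, and X is nonsingular (the quadric defined by f is smooth, i.e. f and its partial derivatives have no common nontrivial zero over the algebraic closure of F_q). -/

import Mathlib

/-- `NP q N` is the number of `F_q`-points of `P^N`, i.e. `q^N + q^(N-1) + … + q + 1`. -/
def NP (q N : ℕ) : ℕ := ∑ i ∈ Finset.range (N + 1), q ^ i

/-- `Theta q d n k` is the quantity `Θ_{n,k}^{d,q} = (d-1)·q^k·N_q(P^{n-k}) + N_q(P^k)`. -/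
def Theta (q d n k : ℕ) : ℕ := (d - 1) * q ^ k * NP q (n - k) + NP q k

/-- The number of `F`-rational points of the hypersurface `f = 0` in `P^{m-1}`. -/
noncomputable def numPoints {F : Type*} [Field F] {m : ℕ}
    (f : MvPolynomial (Fin m) F) : ℕ :=
  Nat.card {p : Projectivization F (Fin m → F) // MvPolynomial.eval p.rep f = 0}

/-- The projective linear subspace `P(W)` is contained in the hypersurface `f = 0`. -/
def SubInX {F : Type*} [Field F] {m : ℕ}
    (f : MvPolynomial (Fin m) F) (W : Submodule F (Fin m → F)) : Prop :=
  ∀ v ∈ W, MvPolynomial.eval v f = 0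

/-- The Thas invariant of the hypersurface `f = 0` equals `k`: there is an `F`-linear
projective subspace of dimension `k` contained in it, and none of dimension `k + 1`. -/
def ThasEq {F : Type*} [Field F] {m : ℕ}
    (f : MvPolynomial (Fin m) F) (k : ℕ) : Prop :=
  (∃ W : Submodule F (Fin m → F), Module.finrank F W = k + 1 ∧ SubInX f W) ∧
  ¬ ∃ W : Submodule F (Fin m → F), Module.finrank F W = k + 2 ∧ SubInX f W

/-- `v` is a homogeneous coordinate vector of a singular `F`-point of `f = 0`. -/
def IsSingPt {F : Type*} [Field F] {m : ℕ}
    (f : MvPolynomial (Fin m) F) (v : Fin m → F) : Prop :=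
  v ≠ 0 ∧ MvPolynomial.eval v f = 0 ∧
    ∀ i, MvPolynomial.eval v (MvPolynomial.pderiv i f) = 0

open MvPolynomial in
/-- The derivative of `f` at `x`, as a linear form in the direction. -/
noncomputable def dirDeriv {R σ : Type*} [CommRing R] [Fintype σ] (f : MvPolynomial σ R)
    (x : σ → R) : (σ → R) →ₗ[R] R :=
  ∑ i, eval x (pderiv i f) • LinearMap.proj i

open MvPolynomial in
/-- The restriction of `f` to the parametrized line `t ↦ x + t • v`. -/
noncomputable def linePoly {R σ : Type*} [CommRing R] (f : MvPolynomial σ R)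
    (x v : σ → R) : Polynomial R :=
  aeval (fun i => Polynomial.C (x i) + Polynomial.X * Polynomial.C (v i)) f

section LinePoly

open MvPolynomial

variable {R σ : Type*} [CommRing R]

theorem dirDeriv_apply [Fintype σ] (f : MvPolynomial σ R) (x v : σ → R) :
    dirDeriv f x v = ∑ i, eval x (pderiv i f) * v i := by
  simp [dirDeriv]

theorem dirDeriv_add_left [Fintype σ] (f g : MvPolynomial σ R) (x v : σ → R) :
    dirDeriv (f + g) x v = dirDeriv f x v + dirDeriv g x v := by
  simp [dirDeriv_apply, add_mul, Finset.sum_add_distrib]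

theorem dirDeriv_mul_X [Fintype σ] (f : MvPolynomial σ R) (i : σ) (x v : σ → R) :
    dirDeriv (f * X i) x v = eval x f * v i + x i * dirDeriv f x v := by
  classical
  simp only [dirDeriv_apply, Derivation.leibniz, pderiv_X, smul_eq_mul, map_add, map_mul, eval_X,
    add_mul, Finset.sum_add_distrib, Finset.mul_sum, mul_assoc]
  congr 1
  rw [Finset.sum_eq_single i] <;> simp +contextual [eq_comm]

theorem linePoly_mul_X (f : MvPolynomial σ R) (i : σ) (x v : σ → R) :
    linePoly (f * X i) x v = linePoly f x v * Polynomial.C (x i) +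
      linePoly f x v * Polynomial.C (v i) * Polynomial.X := by
  simp only [linePoly, map_mul, aeval_X]
  ring

theorem eval_linePoly (f : MvPolynomial σ R) (x v : σ → R) (t : R) :
    (linePoly f x v).eval t = eval (x + t • v) f := by
  induction f using MvPolynomial.induction_on with
  | C a => simp [linePoly]
  | add p q hp hq => simp_all [linePoly]
  | mul_X p i hp => simp [linePoly_mul_X, hp]; ring

theorem coeff_zero_linePoly (f : MvPolynomial σ R) (x v : σ → R) :
    (linePoly f x v).coeff 0 = eval x f := by
  simp [Polynomial.coeff_zero_eq_eval_zero, eval_linePoly]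

theorem coeff_one_linePoly [Fintype σ] (f : MvPolynomial σ R) (x v : σ → R) :
    (linePoly f x v).coeff 1 = dirDeriv f x v := by
  induction f using MvPolynomial.induction_on with
  | C a => simp [linePoly, dirDeriv_apply]
  | add p q hp hq => simpa [dirDeriv_add_left, linePoly] using congr_arg₂ (· + ·) hp hq
  | mul_X p i hp =>
    rw [linePoly_mul_X, dirDeriv_mul_X, Polynomial.coeff_add, Polynomial.coeff_mul_C,
      Polynomial.coeff_mul_X, Polynomial.coeff_mul_C, hp, coeff_zero_linePoly]
    ring

/-- The top two coefficients of a homogeneous polynomial restricted to a line are its value and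
its derivative at the direction of the line. -/
theorem MvPolynomial.IsHomogeneous.linePoly_top [Fintype σ] {f : MvPolynomial σ R} {d : ℕ}
    (hf : f.IsHomogeneous d) (x v : σ → R) :
    (linePoly f x v).natDegree ≤ d ∧ (linePoly f x v).coeff d = eval v f ∧
      (linePoly f x v * Polynomial.X).coeff d = dirDeriv f v x := by
  classical
  have key : ∀ (m : σ →₀ ℕ) (a : R), ∃ e, (monomial m a).IsHomogeneous e ∧
      ((linePoly (monomial m a) x v).natDegree ≤ e ∧
        (linePoly (monomial m a) x v).coeff e = eval v (monomial m a) ∧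
        (linePoly (monomial m a) x v * Polynomial.X).coeff e = dirDeriv (monomial m a) v x) := by
    refine induction_on_monomial (fun a => ⟨0, isHomogeneous_C _ _, ?_⟩) ?_
    · simp [linePoly, dirDeriv_apply]
    · rintro p i ⟨e, hp, h1, h2, h3⟩
      refine ⟨e + 1, hp.mul (isHomogeneous_X _ _), ?_, ?_, ?_⟩
      · rw [linePoly_mul_X]
        refine Polynomial.natDegree_add_le_of_degree_le
          ((Polynomial.natDegree_mul_C_le _ _).trans (h1.trans e.le_succ)) ?_
        exact Polynomial.natDegree_mul_le.trans
          (add_le_add ((Polynomial.natDegree_mul_C_le _ _).trans h1) Polynomial.natDegree_X_le)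
      · rw [linePoly_mul_X, Polynomial.coeff_add, Polynomial.coeff_mul_C, Polynomial.coeff_mul_X,
          Polynomial.coeff_mul_C, h2, Polynomial.coeff_eq_zero_of_natDegree_lt (by lia)]
        simp
      · rw [Polynomial.coeff_mul_X, linePoly_mul_X, Polynomial.coeff_add, Polynomial.coeff_mul_C,
          mul_right_comm, Polynomial.coeff_mul_C, h2, h3, dirDeriv_mul_X]
        ring
  rw [f.as_sum]
  have hm : ∀ m ∈ f.support, m.degree = d := fun m hm => by
    by_contra h
    exact (mem_support_iff.mp hm) (hf.coeff_eq_zero h)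
  refine Finset.sum_induction _ (fun g : MvPolynomial σ R =>
    (linePoly g x v).natDegree ≤ d ∧ (linePoly g x v).coeff d = eval v g ∧
      (linePoly g x v * Polynomial.X).coeff d = dirDeriv g v x) ?_ ?_ ?_
  · rintro p q ⟨h1, h2, h3⟩ ⟨k1, k2, k3⟩
    have h : linePoly (p + q) x v = linePoly p x v + linePoly q x v := map_add _ _ _
    rw [h, dirDeriv_add_left, add_mul, Polynomial.coeff_add, Polynomial.coeff_add, map_add]
    exact ⟨Polynomial.natDegree_add_le_of_degree_le h1 k1, congr_arg₂ _ h2 k2, congr_arg₂ _ h3 k3⟩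
  · simp [linePoly, dirDeriv_apply]
  · intro m h
    obtain ⟨e, he, H⟩ := key m (f.coeff m)
    rwa [he.inj_right (isHomogeneous_monomial _ (hm m h))
      (by simpa using mem_support_iff.mp h)] at H

theorem MvPolynomial.IsHomogeneous.natDegree_linePoly_le [Fintype σ] {f : MvPolynomial σ R}
    {d : ℕ} (hf : f.IsHomogeneous d) {v : σ → R} (hv : eval v f = 0) (x : σ → R) :
    (linePoly f x v).natDegree ≤ d - 1 := by
  obtain ⟨h1, h2, -⟩ := hf.linePoly_top x v
  refine Polynomial.natDegree_le_iff_coeff_eq_zero.mpr fun k hk => ?_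
  rcases (show d ≤ k by lia).eq_or_lt with rfl | hk
  · rw [h2, hv]
  · exact Polynomial.coeff_eq_zero_of_natDegree_lt (by lia)

theorem MvPolynomial.IsHomogeneous.coeff_linePoly_pred [Fintype σ] {f : MvPolynomial σ R}
    {d : ℕ} (hd : 1 ≤ d) (hf : f.IsHomogeneous d) (x v : σ → R) :
    (linePoly f x v).coeff (d - 1) = dirDeriv f v x := by
  obtain ⟨k, rfl⟩ := Nat.exists_eq_add_of_le' hd
  simpa [Polynomial.coeff_mul_X] using (hf.linePoly_top x v).2.2

theorem MvPolynomial.IsHomogeneous.natDegree_linePoly_le_of_dirDeriv_eq_zero [Fintype σ]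
    {f : MvPolynomial σ R} {d : ℕ} (hd : 2 ≤ d) (hf : f.IsHomogeneous d) {v : σ → R}
    (hv : eval v f = 0) {x : σ → R} (hx : dirDeriv f v x = 0) :
    (linePoly f x v).natDegree ≤ d - 2 := by
  have h := hf.natDegree_linePoly_le hv x
  refine Polynomial.natDegree_le_iff_coeff_eq_zero.mpr fun k hk => ?_
  rcases (show d - 1 ≤ k by lia).eq_or_lt with rfl | hk
  · rw [hf.coeff_linePoly_pred (by lia), hx]
  · exact Polynomial.coeff_eq_zero_of_natDegree_lt (by lia)

theorem MvPolynomial.IsHomogeneous.eval_smul' [Fintype σ] {f : MvPolynomial σ R} {d : ℕ}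
    (hf : f.IsHomogeneous d) (a : R) (v : σ → R) : eval (a • v) f = a ^ d * eval v f := by
  simp only [eval_eq', Finset.mul_sum]
  refine Finset.sum_congr rfl fun m hm => ?_
  have : ∑ i, m i = d := by
    rw [← Finsupp.degree_eq_sum]
    by_contra h
    exact (mem_support_iff.mp hm) (hf.coeff_eq_zero h)
  simp only [Pi.smul_apply, smul_eq_mul, mul_pow, Finset.prod_mul_distrib,
    Finset.prod_pow_eq_pow_sum, this]
  ring

/-- The polar form of a quadratic form is its directional derivative. -/
theorem MvPolynomial.IsHomogeneous.eval_add_of_two [Fintype σ] {f : MvPolynomial σ R}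
    (hf : f.IsHomogeneous 2) (x y : σ → R) :
    eval (x + y) f = eval x f + dirDeriv f x y + eval y f := by
  obtain ⟨h1, h2, -⟩ := hf.linePoly_top x y
  have h := eval_linePoly f x y 1
  rw [Polynomial.eval_eq_sum_range' (n := 3) (by lia)] at h
  simp [Finset.sum_range_succ, h2, coeff_zero_linePoly, coeff_one_linePoly] at h
  exact h.symm

end LinePoly

section Singular

open MvPolynomial

variable {F K σ : Type*} [Field F] [Field K] [Algebra F K]

theorem eval_algebraMap_comp (f : MvPolynomial σ F) (u : σ → F) :
    eval (fun i => algebraMap F K (u i)) (map (algebraMap F K) f) =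
      algebraMap F K (eval u f) := by
  rw [eval_map, ← aeval_def]
  exact (aeval_algebraMap_apply K u f).trans (by rw [aeval_eq_eval])

theorem MvPolynomial.IsHomogeneous.map_eval_of_one {g : MvPolynomial σ F} (hg : g.IsHomogeneous 1)
    (φ : K →ₗ[F] F) (v : σ → K) :
    φ (eval v (map (algebraMap F K) g)) = eval (fun i => φ (v i)) g := by
  rw [← mem_homogeneousSubmodule, homogeneousSubmodule_one_eq_span_X] at hg
  induction hg using Submodule.span_induction with
  | mem x h => obtain ⟨i, rfl⟩ := h; simp
  | zero => simp
  | add x y _ _ hx hy => rw [map_add, map_add, map_add, map_add, hx, hy]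
  | smul a x _ hx =>
    have h : eval v (map (algebraMap F K) (C a * x)) =
        a • eval v (map (algebraMap F K) x) := by
      rw [map_mul, map_mul, map_C, eval_C, Algebra.smul_def]
    rw [smul_eq_C_mul, h, map_smul, hx, map_mul, eval_C, smul_eq_mul]

/-- A quadratic form over a finite field that has a singular zero over some extension has a
rational one. -/
theorem exists_isSingPt_of_extension [Finite F] {m : ℕ} {f : MvPolynomial (Fin m) F}
    (hf : f.IsHomogeneous 2) {v : Fin m → K} (hv : v ≠ 0)
    (hfv : eval v (map (algebraMap F K) f) = 0)
    (hdv : ∀ i, eval v (pderiv i (map (algebraMap F K) f)) = 0) :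
    ∃ u, IsSingPt f u := by
  classical
  have := Fintype.ofFinite F
  let b := Module.Free.chooseBasis F K
  let u := fun j i => b.repr (v i) j
  have hdu : ∀ j i, eval (u j) (pderiv i f) = 0 := fun j i => by
    have h := (hf.pderiv (i := i)).map_eval_of_one (b.coord j) v
    rw [← pderiv_map, hdv, map_zero] at h
    exact h.symm
  suffices H : ∀ j, eval (u j) f = 0 by
    obtain ⟨i, hi⟩ := Function.ne_iff.mp hv
    obtain ⟨j, hj⟩ : ∃ j, b.repr (v i) j ≠ 0 := by
      by_contra! h
      exact hi ((LinearEquiv.map_eq_zero_iff b.repr).mp (Finsupp.ext h))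
    exact ⟨u j, fun h => hj (congr_fun h i), H j, hdu j⟩
  by_cases h2 : ringChar F = 2
  · have : CharP F 2 := ringChar.of_eq h2
    have : CharP K 2 := charP_of_injective_algebraMap (algebraMap F K).injective 2
    choose s hs using fun j => FiniteField.isSquare_of_char_two h2 (eval (u j) f)
    let w := fun j i => algebraMap F K (u j i)
    have hdw : ∀ (j) (c : K), ∀ y, dirDeriv (map (algebraMap F K) f) (c • w j) y = 0 := by
      intro j c y
      rw [dirDeriv_apply]
      refine Finset.sum_eq_zero fun i _ => ?_
      have h1 : (pderiv i (map (algebraMap F K) f)).IsHomogeneous 1 := (hf.map _).pderiv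
      rw [h1.eval_smul', pderiv_map, eval_algebraMap_comp, hdu]
      simp
    have key : ∀ S : Finset _, eval (∑ j ∈ S, b j • w j) (map (algebraMap F K) f) =
        (∑ j ∈ S, s j • b j) ^ 2 := by
      intro S
      induction S using Finset.induction_on with
      | empty => simpa using (hf.map (algebraMap F K)).eval_smul' 0 0
      | insert j S hj ih =>
        rw [Finset.sum_insert hj, Finset.sum_insert hj, (hf.map _).eval_add_of_two, hdw, ih,
          CharTwo.add_sq, (hf.map _).eval_smul', eval_algebraMap_comp, hs, Algebra.smul_def]
        simp
        ring
    let S := Finset.univ.biUnion fun i => (b.repr (v i)).support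
    have hvS : v = ∑ j ∈ S, b j • w j := by
      ext i
      conv_lhs => rw [← b.linearCombination_repr (v i), Finsupp.linearCombination_apply]
      rw [Finsupp.sum_of_support_subset _ (Finset.subset_biUnion_of_mem
        (fun i => (b.repr (v i)).support) (Finset.mem_univ i)) _ (by simp)]
      simp [S, w, u, Algebra.smul_def, mul_comm]
    rw [hvS, key] at hfv
    have h0 := linearIndependent_iff'.mp b.linearIndependent S s (by simpa using hfv)
    intro j
    by_cases hj : j ∈ S
    · rw [hs, h0 j hj, zero_mul]
    · have : u j = 0 := by
        ext i
        by_contra h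
        exact hj (Finset.mem_biUnion.mpr ⟨i, Finset.mem_univ i, Finsupp.mem_support_iff.mpr h⟩)
      simpa [this] using hf.eval_smul' 0 0
  · intro j
    have h := congr_arg (eval (u j)) hf.sum_X_mul_pderiv
    simp only [map_sum, map_mul, hdu, mul_zero, Finset.sum_const_zero, nsmul_eq_mul] at h
    have h2' : (2 : F) ≠ 0 := Ring.two_ne_zero h2
    simpa [h2'] using h.symm

end Singular

section Homogeneous

open MvPolynomial

variable {F : Type*} [Field F] {m : ℕ}

theorem MvPolynomial.IsHomogeneous.eval_smul_eq_zero_iff {f : MvPolynomial (Fin m) F} {d : ℕ}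
    (hf : f.IsHomogeneous d) {a : F} (ha : a ≠ 0) (v : Fin m → F) :
    eval (a • v) f = 0 ↔ eval v f = 0 := by
  simp [hf.eval_smul', ha]

theorem MvPolynomial.IsHomogeneous.eval_zero_vec {f : MvPolynomial (Fin m) F} {d : ℕ}
    (hf : f.IsHomogeneous d) (hd : d ≠ 0) : eval (0 : Fin m → F) f = 0 := by
  simpa [hd] using hf.eval_smul' 0 0

theorem dirDeriv_self {f : MvPolynomial (Fin m) F} {d : ℕ} (hf : f.IsHomogeneous d)
    {P : Fin m → F} (hP : eval P f = 0) : dirDeriv f P P = 0 := by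
  have h := congr_arg (eval P) hf.sum_X_mul_pderiv
  simp only [map_sum, map_mul, eval_X, map_nsmul, hP, smul_zero] at h
  simpa [dirDeriv_apply, mul_comm] using h

theorem linePoly_ne_zero {f : MvPolynomial (Fin m) F} {d : ℕ} (hf : f.IsHomogeneous d)
    (hline : ¬ ∃ W : Submodule F (Fin m → F), Module.finrank F W = 2 ∧ SubInX f W)
    {P : Fin m → F} (hP0 : P ≠ 0) (hP : eval P f = 0) {w : Fin m → F}
    (hw : w ∉ Submodule.span F {P}) : linePoly f w P ≠ 0 := by
  intro h
  refine hline ⟨Submodule.span F (Set.range ![P, w]), ?_, ?_⟩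
  · have hli : LinearIndependent F ![P, w] := by
      rw [LinearIndependent.pair_iff' hP0]
      exact fun a ha => hw (Submodule.mem_span_singleton.mpr ⟨a, ha⟩)
    simpa using finrank_span_eq_card hli
  · intro v hv
    rw [Matrix.range_cons, Matrix.range_cons, Matrix.range_empty, Set.union_empty,
      Set.singleton_union, Submodule.mem_span_pair] at hv
    obtain ⟨a, b, rfl⟩ := hv
    by_cases hb : b = 0
    · rw [hb, zero_smul, add_zero, hf.eval_smul', hP, mul_zero]
    · have : eval (w + (b⁻¹ * a) • P) f = 0 := by rw [← eval_linePoly, h, Polynomial.eval_zero]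
      rw [← hf.eval_smul_eq_zero_iff (inv_ne_zero hb), smul_add, inv_smul_smul₀ hb, smul_smul,
        add_comm, this]

theorem isSingPt_iff_dirDeriv_eq_zero {m : ℕ} {f : MvPolynomial (Fin m) F} {v : Fin m → F} :
    IsSingPt f v ↔ v ≠ 0 ∧ eval v f = 0 ∧ dirDeriv f v = 0 := by
  classical
  refine and_congr_right fun _ => and_congr_right fun _ => ⟨fun h => ?_, fun h i => ?_⟩
  · ext w
    simp [dirDeriv_apply, h]
  · simpa [dirDeriv_apply, Pi.single_apply] using LinearMap.congr_fun h (Pi.single i 1)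

end Homogeneous

section Counting

open MvPolynomial

variable {F : Type*} [Field F] [Fintype F] {m : ℕ}

/-- The number of zeros of `f` among the vectors `w + s • P`. -/
noncomputable def lineCount (f : MvPolynomial (Fin m) F) (P w : Fin m → F) : ℕ :=
  Nat.card {s : F // eval (w + s • P) f = 0}

open Classical in
theorem lineCount_eq_card_filter (f : MvPolynomial (Fin m) F) (P w : Fin m → F) :
    lineCount f P w = (Finset.univ.filter fun s : F => eval (w + s • P) f = 0).card := by
  rw [lineCount, Nat.card_eq_fintype_card, Fintype.card_subtype]

theorem numPoints_mul_add_one {f : MvPolynomial (Fin m) F} {d : ℕ} (hf : f.IsHomogeneous d)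
    (hd : d ≠ 0) :
    numPoints f * (Fintype.card F - 1) + 1 = Nat.card {v : Fin m → F // eval v f = 0} := by
  classical
  let e : {p : Projectivization F (Fin m → F) // eval p.rep f = 0} × Fˣ →
      {v : {v : Fin m → F // eval v f = 0} // v ≠ ⟨0, hf.eval_zero_vec hd⟩} := fun x =>
    ⟨⟨(x.2 : F) • x.1.1.rep, (hf.eval_smul_eq_zero_iff x.2.ne_zero _).mpr x.1.2⟩, fun h =>
      smul_ne_zero x.2.ne_zero x.1.1.rep_nonzero (congr_arg Subtype.val h)⟩
  have he : Function.Bijective e := by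
    constructor
    · rintro ⟨⟨p, hp⟩, a⟩ ⟨⟨p', hp'⟩, a'⟩ h
      have h1 : (a : F) • p.rep = (a' : F) • p'.rep :=
        congr_arg (fun x => x.1.1) h
      have hpp : p = p' := by
        rw [← p.mk_rep, ← p'.mk_rep, Projectivization.mk_eq_mk_iff]
        exact ⟨a⁻¹ * a', by
          rw [mul_smul, Units.smul_def a', ← h1, ← Units.smul_def, inv_smul_smul]⟩
      subst hpp
      have := smul_left_injective F p.rep_nonzero h1
      simpa using Units.ext this
    · rintro ⟨⟨v, hv⟩, h0⟩
      have hv0 : v ≠ 0 := fun h => h0 (Subtype.ext h)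
      obtain ⟨a, ha⟩ := Projectivization.exists_smul_eq_mk_rep F v hv0
      have hva : v = ((a⁻¹ : Fˣ) : F) • (Projectivization.mk F v hv0).rep := by
        rw [← ha, ← Units.smul_def, inv_smul_smul]
      refine ⟨⟨⟨Projectivization.mk F v hv0, ?_⟩, a⁻¹⟩, ?_⟩
      · rw [← ha, Units.smul_def, hf.eval_smul_eq_zero_iff a.ne_zero, hv]
      · exact Subtype.ext (Subtype.ext hva.symm)
  have h := Nat.card_congr (Equiv.ofBijective e he)
  rw [Nat.card_prod, Nat.card_units, Nat.card_eq_fintype_card (α := F),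
    Nat.card_eq_fintype_card (α := {v : {v : Fin m → F // eval v f = 0} // _}),
    Fintype.card_subtype_compl, Fintype.card_subtype_eq] at h
  have hpos : 0 < Fintype.card {v : Fin m → F // eval v f = 0} :=
    Fintype.card_pos_iff.mpr ⟨0, hf.eval_zero_vec hd⟩
  rw [numPoints, h, Nat.card_eq_fintype_card]
  lia

theorem sum_lineCount (f : MvPolynomial (Fin m) F) (P : Fin m → F) :
    ∑ w, lineCount f P w = Fintype.card F * Nat.card {v : Fin m → F // eval v f = 0} := by
  classical
  simp only [lineCount_eq_card_filter, Finset.card_filter]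
  rw [Finset.sum_comm, Nat.card_eq_fintype_card, Fintype.card_subtype, Finset.card_filter]
  have h : ∀ s : F, (∑ w : Fin m → F, if eval (w + s • P) f = 0 then 1 else 0) =
      ∑ v : Fin m → F, if eval v f = 0 then 1 else 0 := fun s =>
    Fintype.sum_equiv (Equiv.addRight (s • P)) _ _ fun w => rfl
  simp only [h, Finset.sum_const, Finset.card_univ, smul_eq_mul]

theorem lineCount_comm {f : MvPolynomial (Fin m) F} {d : ℕ} (hf : f.IsHomogeneous d)
    {P Q : Fin m → F} (hP : eval P f = 0) (hQ : eval Q f = 0) :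
    lineCount f P Q = lineCount f Q P := by
  classical
  have key : ∀ {P Q : Fin m → F}, eval P f = 0 → ∀ s : F,
      eval (Q + s • P) f = 0 → eval (P + s⁻¹ • Q) f = 0 := by
    intro P Q hP s hs
    by_cases h0 : s = 0
    · simpa [h0] using hP
    · rw [← hf.eval_smul_eq_zero_iff h0, smul_add, smul_inv_smul₀ h0, add_comm, hs]
  rw [lineCount_eq_card_filter, lineCount_eq_card_filter]
  refine Finset.card_nbij' (·⁻¹) (·⁻¹) ?_ ?_ ?_ ?_
  · intro s hs
    simpa using key hP s (by simpa using hs)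
  · intro s hs
    simpa using key hQ s (by simpa using hs)
  · simp [Set.LeftInvOn]
  · simp [Set.LeftInvOn]

theorem lineCount_of_mem_span {f : MvPolynomial (Fin m) F} {d : ℕ} (hf : f.IsHomogeneous d)
    {P : Fin m → F} (hP : eval P f = 0) {w : Fin m → F}
    (hw : w ∈ Submodule.span F {P}) : lineCount f P w = Fintype.card F := by
  classical
  obtain ⟨a, rfl⟩ := Submodule.mem_span_singleton.mp hw
  rw [lineCount_eq_card_filter, Finset.filter_true_of_mem, Finset.card_univ]
  intro s _
  rw [← add_smul, hf.eval_smul', hP, mul_zero]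

theorem lineCount_eq_card_roots [DecidableEq F] {f : MvPolynomial (Fin m) F} {P w : Fin m → F}
    (h : linePoly f w P ≠ 0) : lineCount f P w = (linePoly f w P).roots.toFinset.card := by
  rw [lineCount_eq_card_filter]
  congr 1
  ext s
  simp [h, eval_linePoly]

theorem lineCount_le_natDegree {f : MvPolynomial (Fin m) F} {P w : Fin m → F}
    (h : linePoly f w P ≠ 0) : lineCount f P w ≤ (linePoly f w P).natDegree := by
  classical
  rw [lineCount_eq_card_roots h]
  exact (Multiset.toFinset_card_le _).trans (Polynomial.card_roots' _)

open Classical in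
/-- The largest possible value of `lineCount f P w` on a hypersurface without lines. -/
noncomputable def lineBound (f : MvPolynomial (Fin m) F) (d : ℕ) (P w : Fin m → F) : ℤ :=
  (d - 1) - (if w ∈ LinearMap.ker (dirDeriv f P) then 1 else 0) +
    (if w ∈ Submodule.span F {P} then 1 else 0) * (Fintype.card F - d + 2)

theorem lineBound_of_mem_span {f : MvPolynomial (Fin m) F} {d : ℕ} (hf : f.IsHomogeneous d)
    {P w : Fin m → F} (hP : eval P f = 0) (hw : w ∈ Submodule.span F {P}) :
    lineBound f d P w = Fintype.card F := by
  have hT : w ∈ LinearMap.ker (dirDeriv f P) := by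
    refine (Submodule.span_singleton_le_iff_mem _ _).mpr ?_ hw
    exact dirDeriv_self hf hP
  rw [lineBound, if_pos hT, if_pos hw]
  ring

theorem lineBound_of_mem_ker {f : MvPolynomial (Fin m) F} {d : ℕ} {P w : Fin m → F}
    (hw : w ∉ Submodule.span F {P}) (hT : dirDeriv f P w = 0) :
    lineBound f d P w = d - 2 := by
  rw [lineBound, if_pos (LinearMap.mem_ker.mpr hT), if_neg hw]
  ring

theorem lineBound_of_notMem_ker {f : MvPolynomial (Fin m) F} {d : ℕ} {P w : Fin m → F}
    (hw : w ∉ Submodule.span F {P}) (hT : dirDeriv f P w ≠ 0) :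
    lineBound f d P w = d - 1 := by
  rw [lineBound, if_neg (by simpa using hT), if_neg hw]
  ring

theorem lineCount_le_lineBound {f : MvPolynomial (Fin m) F} {d : ℕ} (hf : f.IsHomogeneous d)
    (hd : 2 ≤ d)
    (hline : ¬ ∃ W : Submodule F (Fin m → F), Module.finrank F W = 2 ∧ SubInX f W)
    {P : Fin m → F} (hP0 : P ≠ 0) (hP : eval P f = 0) (w : Fin m → F) :
    (lineCount f P w : ℤ) ≤ lineBound f d P w := by
  by_cases hw : w ∈ Submodule.span F {P}
  · rw [lineBound_of_mem_span hf hP hw, lineCount_of_mem_span hf hP hw]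
  have h := lineCount_le_natDegree (linePoly_ne_zero hf hline hP0 hP hw)
  by_cases hT : dirDeriv f P w = 0
  · have := hf.natDegree_linePoly_le_of_dirDeriv_eq_zero hd hP hT
    rw [lineBound_of_mem_ker hw hT]
    lia
  · have := hf.natDegree_linePoly_le hP w
    rw [lineBound_of_notMem_ker hw hT]
    lia

open Classical in
theorem sum_lineBound (f : MvPolynomial (Fin m) F) (d : ℕ) {P : Fin m → F} (hP0 : P ≠ 0) :
    ∑ w, lineBound f d P w = (Fintype.card F : ℤ) ^ m * (d - 1) -
      Fintype.card (LinearMap.ker (dirDeriv f P)) +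
      Fintype.card F * (Fintype.card F - d + 2) := by
  have h1 : (∑ w : Fin m → F, if w ∈ LinearMap.ker (dirDeriv f P) then (1 : ℤ) else 0) =
      Fintype.card (LinearMap.ker (dirDeriv f P)) := by
    rw [Finset.sum_boole, Fintype.card_subtype]
  have h2 : (∑ w : Fin m → F, if w ∈ Submodule.span F {P} then (1 : ℤ) else 0) =
      Fintype.card F := by
    rw [Finset.sum_boole, ← Fintype.card_subtype,
      Module.card_eq_pow_finrank (K := F) (V := Submodule.span F {P}),
      finrank_span_singleton hP0, pow_one]
  simp only [lineBound, Finset.sum_add_distrib, Finset.sum_sub_distrib, ← Finset.sum_mul, h1, h2]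
  simp [mul_sub]

open Classical in
theorem card_ker_of_ne_zero {k : ℕ} {L : (Fin (k + 1) → F) →ₗ[F] F} (hL : L ≠ 0) :
    Fintype.card (LinearMap.ker L) = Fintype.card F ^ k := by
  have := Module.Dual.finrank_ker_add_one_of_ne_zero hL
  rw [Module.finrank_fin_fun] at this
  rw [Module.card_eq_pow_finrank (K := F), show Module.finrank F (LinearMap.ker L) = k by lia]

theorem numPoints_eq_iff_sum_lineCount {n d : ℕ} (hn : 1 ≤ n) (hd : 2 ≤ d)
    {f : MvPolynomial (Fin (n + 2)) F} (hf : f.IsHomogeneous d) (P : Fin (n + 2) → F) :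
    numPoints f = (d - 1) * Fintype.card F ^ n + (d - 2) * NP (Fintype.card F) (n - 1) + 1 ↔
      ((∑ w, lineCount f P w : ℕ) : ℤ) = (Fintype.card F : ℤ) ^ (n + 2) * (d - 1) -
        Fintype.card F ^ (n + 1) + Fintype.card F * (Fintype.card F - d + 2) := by
  rw [sum_lineCount, ← numPoints_mul_add_one hf (by lia)]
  have hq : 1 < Fintype.card F := Fintype.one_lt_card
  have hNP : (NP (Fintype.card F) (n - 1) : ℤ) * (Fintype.card F - 1) = Fintype.card F ^ n - 1 := by
    rw [NP, Nat.sub_add_cancel hn]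
    push_cast
    exact geom_sum_mul _ _
  rw [← Nat.cast_inj (R := ℤ)]
  push_cast [Nat.cast_sub hq.le, Nat.cast_sub hd, Nat.cast_sub (show 1 ≤ d by lia)]
  have hq' : (1 : ℤ) < Fintype.card F := by exact_mod_cast hq
  set q : ℤ := (Fintype.card F : ℤ)
  have hne : q * (q - 1) ≠ 0 := mul_ne_zero (by lia) (by lia)
  rw [← mul_right_inj' hne]
  constructor
  · intro h
    linear_combination h + q * (d - 2) * hNP
  · intro h
    linear_combination h - q * (d - 2) * hNP

end Counting

section Extremal

open MvPolynomial

variable {F : Type*} [Field F] [Fintype F]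

theorem sum_lineBound_of_ne_zero {k : ℕ} (f : MvPolynomial (Fin (k + 1)) F) (d : ℕ)
    {P : Fin (k + 1) → F} (hP0 : P ≠ 0) (hL : dirDeriv f P ≠ 0) :
    ∑ w, lineBound f d P w = (Fintype.card F : ℤ) ^ (k + 1) * (d - 1) -
      Fintype.card F ^ k + Fintype.card F * (Fintype.card F - d + 2) := by
  classical
  rw [sum_lineBound f d hP0]
  congr 2
  exact_mod_cast card_ker_of_ne_zero hL

/-- A hypersurface without lines attaining the maximal number of points is nonsingular at each of
its rational points, and every line through such a point attains its bound. -/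
theorem lineCount_eq_lineBound {n d : ℕ} (hn : 1 ≤ n) (hd : 2 ≤ d)
    {f : MvPolynomial (Fin (n + 2)) F} (hf : f.IsHomogeneous d)
    (hline : ¬ ∃ W : Submodule F (Fin (n + 2) → F), Module.finrank F W = 2 ∧ SubInX f W)
    (hN : numPoints f =
      (d - 1) * Fintype.card F ^ n + (d - 2) * NP (Fintype.card F) (n - 1) + 1)
    {P : Fin (n + 2) → F} (hP0 : P ≠ 0) (hP : eval P f = 0) :
    dirDeriv f P ≠ 0 ∧ ∀ w, (lineCount f P w : ℤ) = lineBound f d P w := by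
  classical
  rw [numPoints_eq_iff_sum_lineCount hn hd hf P, Nat.cast_sum] at hN
  have hle := fun w (_ : w ∈ Finset.univ) => lineCount_le_lineBound hf hd hline hP0 hP w
  have hL : dirDeriv f P ≠ 0 := by
    intro h0
    have h := Finset.sum_le_sum hle
    have hcard : Fintype.card (LinearMap.ker (dirDeriv f P)) = Fintype.card F ^ (n + 2) := by
      rw [Module.card_eq_pow_finrank (K := F), h0, LinearMap.ker_zero, finrank_top,
        Module.finrank_fin_fun]
    rw [hN, sum_lineBound f d hP0, hcard] at h
    have hlt : (Fintype.card F : ℤ) ^ (n + 1) < (Fintype.card F : ℤ) ^ (n + 2) := by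
      exact_mod_cast Nat.pow_lt_pow_right Fintype.one_lt_card (Nat.lt_succ_self _)
    push_cast at h
    linarith
  refine ⟨hL, fun w => (Finset.sum_eq_sum_iff_of_le hle).mp ?_ w (Finset.mem_univ w)⟩
  rw [hN, sum_lineBound_of_ne_zero f d hP0 hL]

theorem degree_eq_two_of_numPoints_eq {n d : ℕ} (hn : 1 ≤ n) (hd : 2 ≤ d)
    {f : MvPolynomial (Fin (n + 2)) F} (hf : f.IsHomogeneous d)
    (hline : ¬ ∃ W : Submodule F (Fin (n + 2) → F), Module.finrank F W = 2 ∧ SubInX f W)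
    (hN : numPoints f =
      (d - 1) * Fintype.card F ^ n + (d - 2) * NP (Fintype.card F) (n - 1) + 1) : d = 2 := by
  classical
  by_contra hd2
  obtain ⟨P, hP0, hP⟩ : ∃ P : Fin (n + 2) → F, P ≠ 0 ∧ eval P f = 0 := by
    have hpos : 0 < numPoints f := by rw [hN]; exact Nat.succ_pos _
    obtain ⟨⟨p, hp⟩⟩ := (Nat.card_pos_iff.mp hpos).1
    exact ⟨p.rep, p.rep_nonzero, hp⟩
  obtain ⟨hLP, hPB⟩ := lineCount_eq_lineBound hn hd hf hline hN hP0 hP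
  obtain ⟨w, hwT, hwS⟩ : ∃ w ∈ LinearMap.ker (dirDeriv f P), w ∉ Submodule.span F {P} := by
    by_contra! h
    have h1 := Submodule.finrank_mono (R := F) (show _ ≤ Submodule.span F {P} from h)
    have h2 := Module.Dual.finrank_ker_add_one_of_ne_zero hLP
    rw [finrank_span_singleton hP0] at h1
    rw [Module.finrank_fin_fun] at h2
    lia
  obtain ⟨s, hs⟩ : ∃ s : F, eval (w + s • P) f = 0 := by
    have h := hPB w
    rw [lineBound_of_mem_ker hwS hwT] at h
    have hpos : 0 < lineCount f P w := by lia
    obtain ⟨⟨s, hs⟩⟩ := (Nat.card_pos_iff.mp hpos).1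
    exact ⟨s, hs⟩
  have hsP : s • P ∈ Submodule.span F {P} :=
    Submodule.smul_mem _ _ (Submodule.mem_span_singleton_self P)
  generalize hQ : w + s • P = Q at hs
  have hQS : Q ∉ Submodule.span F {P} := by
    rwa [← hQ, Submodule.add_mem_iff_left _ hsP]
  have hQT : dirDeriv f P Q = 0 := by
    rw [← hQ, map_add, map_smul, dirDeriv_self hf hP, LinearMap.mem_ker.mp hwT]
    simp
  have hQ0 : Q ≠ 0 := fun h => hQS (h ▸ Submodule.zero_mem _)
  have hPS : P ∉ Submodule.span F {Q} := by
    intro h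
    obtain ⟨a, ha⟩ := Submodule.mem_span_singleton.mp h
    have ha0 : a ≠ 0 := fun h0 => hP0 (by rw [← ha, h0, zero_smul])
    exact hQS (Submodule.mem_span_singleton.mpr ⟨a⁻¹, by rw [← ha, inv_smul_smul₀ ha0]⟩)
  have hcount := hPB Q
  rw [lineBound_of_mem_ker hQS hQT] at hcount
  have hsimple : dirDeriv f Q P ≠ 0 := by
    have hne := linePoly_ne_zero hf hline hP0 hP hQS
    have hdeg := hf.natDegree_linePoly_le_of_dirDeriv_eq_zero hd hP hQT
    have hroots := lineCount_eq_card_roots hne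
    have hnodup : (linePoly f Q P).roots.Nodup := by
      rw [← Multiset.toFinset_card_eq_card_iff_nodup]
      have := Multiset.toFinset_card_le (linePoly f Q P).roots
      have := Polynomial.card_roots' (linePoly f Q P)
      lia
    intro h0
    have hmult : 1 < (linePoly f Q P).rootMultiplicity 0 := by
      rw [Polynomial.one_lt_rootMultiplicity_iff_isRoot hne, Polynomial.IsRoot, Polynomial.IsRoot,
        ← Polynomial.coeff_zero_eq_eval_zero, ← Polynomial.coeff_zero_eq_eval_zero,
        Polynomial.coeff_derivative, coeff_zero_linePoly, zero_add, coeff_one_linePoly, hs, h0]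
      simp
    have := Multiset.nodup_iff_count_le_one.mp hnodup 0
    rw [Polynomial.count_roots] at this
    lia
  have hQB := (lineCount_eq_lineBound hn hd hf hline hN hQ0 hs).2 P
  rw [lineBound_of_notMem_ker hPS hsimple, ← lineCount_comm hf hP hs] at hQB
  lia

theorem numPoints_eq_of_dirDeriv_ne_zero {n : ℕ} (hn : 1 ≤ n)
    {f : MvPolynomial (Fin (n + 2)) F} (hf : f.IsHomogeneous 2)
    (hline : ¬ ∃ W : Submodule F (Fin (n + 2) → F), Module.finrank F W = 2 ∧ SubInX f W)
    {P : Fin (n + 2) → F} (hP0 : P ≠ 0) (hP : eval P f = 0) (hL : dirDeriv f P ≠ 0) :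
    numPoints f =
      (2 - 1) * Fintype.card F ^ n + (2 - 2) * NP (Fintype.card F) (n - 1) + 1 := by
  rw [numPoints_eq_iff_sum_lineCount hn le_rfl hf P, ← sum_lineBound_of_ne_zero f 2 hP0 hL,
    Nat.cast_sum]
  refine Finset.sum_congr rfl fun w _ =>
    le_antisymm (lineCount_le_lineBound hf le_rfl hline hP0 hP w) ?_
  by_cases hwS : w ∈ Submodule.span F {P}
  · rw [lineBound_of_mem_span hf hP hwS, lineCount_of_mem_span hf hP hwS]
  by_cases hwT : dirDeriv f P w = 0
  · rw [lineBound_of_mem_ker hwS hwT]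
    simp
  · rw [lineBound_of_notMem_ker hwS hwT]
    have : Nonempty {s : F // eval (w + s • P) f = 0} := by
      refine ⟨⟨-(dirDeriv f P w)⁻¹ * eval w f, ?_⟩⟩
      have h1 : (linePoly f w P).coeff 1 = dirDeriv f P w := hf.coeff_linePoly_pred (by lia) w P
      rw [← eval_linePoly,
        Polynomial.eval_eq_sum_range' (n := 2) (by have := hf.natDegree_linePoly_le hP w; lia)]
      simp [Finset.sum_range_succ, coeff_zero_linePoly, h1]
      field_simp
      ring
    have hpos : 0 < lineCount f P w := Nat.card_pos
    push_cast
    lia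

theorem exists_ne_zero_forall_eval_eq_zero {ι : Type*} [Fintype ι] {m : ℕ}
    {g : ι → MvPolynomial (Fin m) F} (h0 : ∀ j, eval (0 : Fin m → F) (g j) = 0)
    (hdeg : ∑ j, (g j).totalDegree < m) : ∃ x : Fin m → F, x ≠ 0 ∧ ∀ j, eval x (g j) = 0 := by
  classical
  have h := char_dvd_card_solutions_of_fintype_sum_lt (ringChar F) (f := g) (by simpa using hdeg)
  by_contra! hx
  refine (CharP.char_is_prime F (ringChar F)).ne_one (Nat.dvd_one.mp ?_)
  rwa [Fintype.card_eq_one_iff.mpr ⟨⟨0, h0⟩, fun y => Subtype.ext ?_⟩] at h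
  by_contra hy
  obtain ⟨j, hj⟩ := hx y hy
  exact hj (y.2 j)

theorem exists_ne_zero_eval_eq_zero {m : ℕ} (hm : 2 < m) {f : MvPolynomial (Fin m) F}
    (hf : f.IsHomogeneous 2) : ∃ P : Fin m → F, P ≠ 0 ∧ eval P f = 0 := by
  obtain ⟨P, hP0, hP⟩ := exists_ne_zero_forall_eval_eq_zero (g := fun _ : Unit => f)
    (fun _ => hf.eval_zero_vec two_ne_zero) (by simpa using hf.totalDegree_le.trans_lt hm)
  exact ⟨P, hP0, hP ()⟩

theorem exists_line_of_four_lt {m : ℕ} (hm : 4 < m) {f : MvPolynomial (Fin m) F}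
    (hf : f.IsHomogeneous 2) :
    ∃ W : Submodule F (Fin m → F), Module.finrank F W = 2 ∧ SubInX f W := by
  classical
  by_contra hline
  obtain ⟨P, hP0, hP⟩ := exists_ne_zero_eval_eq_zero (by lia) hf
  obtain ⟨i, hi⟩ := Function.ne_iff.mp hP0
  let ℓ : MvPolynomial (Fin m) F := ∑ j, C (eval P (pderiv j f)) * X j
  have hℓ : ℓ.IsHomogeneous 1 := IsHomogeneous.sum _ _ _ fun j _ => isHomogeneous_C_mul_X _ _
  have hℓe : ∀ w, eval w ℓ = dirDeriv f P w := fun w => by simp [ℓ, dirDeriv_apply]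
  let g : Fin 3 → MvPolynomial (Fin m) F := ![f, ℓ, X i]
  have hg0 : ∀ j, eval (0 : Fin m → F) (g j) = 0 := by
    intro j
    fin_cases j
    · exact hf.eval_zero_vec two_ne_zero
    · exact hℓ.eval_zero_vec one_ne_zero
    · exact eval_X i
  have hg : ∑ j, (g j).totalDegree < m := by
    have h1 := hf.totalDegree_le
    have h2 := hℓ.totalDegree_le
    rw [Fin.sum_univ_three]
    change f.totalDegree + ℓ.totalDegree + (X i : MvPolynomial (Fin m) F).totalDegree < m
    rw [totalDegree_X]
    lia
  obtain ⟨w, hw0, hw⟩ := exists_ne_zero_forall_eval_eq_zero hg0 hg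
  have hwf : eval w f = 0 := hw 0
  have hwT : dirDeriv f P w = 0 := (hℓe w).symm.trans (hw 1)
  have hwi : w i = 0 := by simpa [g] using hw 2
  have hwS : w ∉ Submodule.span F {P} := by
    intro h
    obtain ⟨a, rfl⟩ := Submodule.mem_span_singleton.mp h
    have ha : a = 0 := by simpa [show P i ≠ 0 from hi] using hwi
    exact hw0 (by rw [ha, zero_smul])
  have h := lineCount_le_lineBound hf le_rfl hline hP0 hP w
  rw [lineBound_of_mem_ker hwS hwT] at h
  have : Nonempty {s : F // eval (w + s • P) f = 0} := ⟨⟨0, by simpa using hwf⟩⟩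
  have hpos : 0 < lineCount f P w := Nat.card_pos
  push_cast at h
  lia

end Extremal

theorem stmt14 {F : Type*} [Field F] [Fintype F] {n d : ℕ}
    (hn : 1 ≤ n) (hd : 2 ≤ d)
    (f : MvPolynomial (Fin (n + 2)) F) (hf0 : f ≠ 0) (hsq : Squarefree f)
    (hhom : f.IsHomogeneous d)
    (hline : ¬ ∃ W : Submodule F (Fin (n + 2) → F), Module.finrank F W = 2 ∧ SubInX f W) :
    numPoints f = (d - 1) * Fintype.card F ^ n + (d - 2) * NP (Fintype.card F) (n - 1) + 1 ↔
      d = 2 ∧ (n = 1 ∨ n = 2) ∧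
        ¬ ∃ v : Fin (n + 2) → AlgebraicClosure F, v ≠ 0 ∧
          MvPolynomial.eval v (MvPolynomial.map (algebraMap F (AlgebraicClosure F)) f) = 0 ∧
          ∀ i, MvPolynomial.eval v
            (MvPolynomial.pderiv i (MvPolynomial.map (algebraMap F (AlgebraicClosure F)) f)) = 0 := by
  constructor
  · intro hN
    obtain rfl := degree_eq_two_of_numPoints_eq hn hd hhom hline hN
    refine ⟨rfl, ?_, ?_⟩
    · by_contra hn2
      exact hline (exists_line_of_four_lt (by lia) hhom)
    · rintro ⟨v, hv, hfv, hdv⟩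
      obtain ⟨u, hu⟩ := exists_isSingPt_of_extension hhom hv hfv hdv
      obtain ⟨hu0, hfu, hdu⟩ := isSingPt_iff_dirDeriv_eq_zero.mp hu
      exact (lineCount_eq_lineBound hn hd hhom hline hN hu0 hfu).1 hdu
  · rintro ⟨rfl, -, hns⟩
    obtain ⟨P, hP0, hP⟩ := exists_ne_zero_eval_eq_zero (by lia) hhom
    refine numPoints_eq_of_dirDeriv_ne_zero hn hhom hline hP0 hP fun hL => hns ?_
    have hsing := (isSingPt_iff_dirDeriv_eq_zero.mpr ⟨hP0, hP, hL⟩).2.2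
    refine ⟨fun i => algebraMap F _ (P i), fun h => hP0 (funext fun i => ?_), ?_, fun i => ?_⟩
    · simpa using congr_fun h i
    · rw [eval_algebraMap_comp, hP, map_zero]
    · rw [MvPolynomial.pderiv_map, eval_algebraMap_comp, hsing i, map_zero]
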